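/- Let G be a finite graph with n = |V(G)| ≥ 2 vertices and let P_r be the path on r ≥ 3 vertices. Then the r-distance mutual-visibility number of the corona product satisfies μ_r(P_r ⊙ G) = (r−1)·n + 1. -/

import Mathlib

open SimpleGraph

/-- Two vertices `x, y` are `S_k`-visible in `G`: there is a shortest `x,y`-path of length
at most `k` none of whose internal vertices lies in `S`. -/
def SKVisible {V : Type*} (G : SimpleGraph V) (S : Set V) (k : ℕ) (x y : V) : Prop :=
  ∃ p : G.Walk x y, p.IsPath ∧ p.length = G.dist x y ∧ p.length ≤ k ∧
    ∀ v ∈ p.support, v ∈ S → v = x ∨ v = y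

/-- `S` is a `k`-distance mutual-visibility set of `G`. -/
def IsKDistMutualVisSet {V : Type*} (G : SimpleGraph V) (k : ℕ) (S : Set V) : Prop :=
  ∀ ⦃x⦄, x ∈ S → ∀ ⦃y⦄, y ∈ S → SKVisible G S k x y

/-- The `k`-distance mutual-visibility number `μ_k(G)`. -/
noncomputable def kdistMu {V : Type*} (G : SimpleGraph V) (k : ℕ) : ℕ :=
  sSup {n | ∃ S : Finset V, IsKDistMutualVisSet G k ↑S ∧ S.card = n}

/-- Two vertices `x, y` are `S`-visible in `G`. -/
def SVisible {V : Type*} (G : SimpleGraph V) (S : Set V) (x y : V) : Prop :=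
  ∃ p : G.Walk x y, p.IsPath ∧ p.length = G.dist x y ∧
    ∀ v ∈ p.support, v ∈ S → v = x ∨ v = y

/-- `S` is a mutual-visibility set of `G`. -/
def IsMutualVisSet {V : Type*} (G : SimpleGraph V) (S : Set V) : Prop :=
  ∀ ⦃x⦄, x ∈ S → ∀ ⦃y⦄, y ∈ S → SVisible G S x y

/-- The mutual-visibility number `μ(G)`. -/
noncomputable def mutualVisNum {V : Type*} (G : SimpleGraph V) : ℕ :=
  sSup {n | ∃ S : Finset V, IsMutualVisSet G ↑S ∧ S.card = n}

/-- The corona product `G ⊙ H`: one copy of `G` together with a copy of `H` for each vertex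
`a` of `G`, joining `a` to every vertex of its copy of `H`. -/
def corona {α β : Type*} (G : SimpleGraph α) (H : SimpleGraph β) :
    SimpleGraph (α ⊕ (α × β)) :=
  SimpleGraph.fromRel (fun x y =>
    (∃ a a' : α, x = Sum.inl a ∧ y = Sum.inl a' ∧ G.Adj a a') ∨
    (∃ (a : α) (b : β), x = Sum.inl a ∧ y = Sum.inr (a, b)) ∨
    (∃ (a : α) (b b' : β), x = Sum.inr (a, b) ∧ y = Sum.inr (a, b') ∧ H.Adj b b'))

section CoronaAdj

variable {α β : Type*} {G : SimpleGraph α} {H : SimpleGraph β}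

@[simp]
theorem corona_adj_inl_inl {a a' : α} :
    (corona G H).Adj (Sum.inl a) (Sum.inl a') ↔ G.Adj a a' := by
  simp only [corona, fromRel_adj]
  constructor
  · rintro ⟨-, h⟩
    simpa [G.adj_comm a' a] using h
  · intro h
    exact ⟨by simpa using h.ne, Or.inl (Or.inl ⟨a, a', rfl, rfl, h⟩)⟩

@[simp]
theorem corona_adj_inl_inr {a : α} {x : α × β} :
    (corona G H).Adj (Sum.inl a) (Sum.inr x) ↔ a = x.1 := by
  obtain ⟨c, b⟩ := x
  simp [corona, fromRel_adj, eq_comm]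

@[simp]
theorem corona_adj_inr_inl {a : α} {x : α × β} :
    (corona G H).Adj (Sum.inr x) (Sum.inl a) ↔ a = x.1 := by
  rw [adj_comm, corona_adj_inl_inr]

@[simp]
theorem corona_adj_inr_inr {x y : α × β} :
    (corona G H).Adj (Sum.inr x) (Sum.inr y) ↔ x.1 = y.1 ∧ H.Adj x.2 y.2 := by
  obtain ⟨a, b⟩ := x
  obtain ⟨a', b'⟩ := y
  simp only [corona, fromRel_adj]
  constructor
  · rintro ⟨-, h⟩
    rcases h with (h | h | ⟨c, d, d', h, h', hd⟩) | (h | h | ⟨c, d, d', h, h', hd⟩)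
    · simp at h
    · simp at h
    · simp only [Sum.inr.injEq, Prod.mk.injEq] at h h'
      obtain ⟨rfl, rfl⟩ := h
      obtain ⟨rfl, rfl⟩ := h'
      exact ⟨rfl, hd⟩
    · simp at h
    · simp at h
    · simp only [Sum.inr.injEq, Prod.mk.injEq] at h h'
      obtain ⟨rfl, rfl⟩ := h
      obtain ⟨rfl, rfl⟩ := h'
      exact ⟨rfl, hd.symm⟩
  · rintro ⟨h, hd⟩
    subst h
    exact ⟨by simpa using hd.ne, Or.inl (Or.inr (Or.inr ⟨a, b, b', rfl, rfl, hd⟩))⟩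

/-- A walk that leaves a copy of `H` in the corona passes through the root of that copy. -/
theorem corona_root_mem_support {a : α} {b : β} {y : α ⊕ α × β}
    (p : (corona G H).Walk (Sum.inr (a, b)) y) (hy : ∀ c, y ≠ Sum.inr (a, c)) :
    Sum.inl a ∈ p.support := by
  obtain ⟨d, hd, ⟨c, hc⟩, h⟩ := p.exists_boundary_dart {v | ∃ c, v = Sum.inr (a, c)}
    ⟨b, rfl⟩ (by rintro ⟨c, hc⟩; exact hy c hc)
  have hadj := d.adj
  have hs := p.dart_snd_mem_support_of_mem_darts hd
  change d.fst = _ at hc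
  rw [hc] at hadj
  rcases hv : d.snd with a' | ⟨a', c'⟩
  · rw [hv] at hadj hs
    rw [corona_adj_inr_inl] at hadj
    rwa [hadj] at hs
  · rw [hv, corona_adj_inr_inr] at hadj
    obtain ⟨h1, -⟩ := hadj
    subst h1
    exact absurd ⟨c', hv⟩ h

end CoronaAdj

theorem SKVisible.symm {V : Type*} {G : SimpleGraph V} {S : Set V} {k : ℕ} {x y : V}
    (h : SKVisible G S k x y) : SKVisible G S k y x := by
  obtain ⟨p, hp, hd, hk, hS⟩ := h
  refine ⟨p.reverse, hp.reverse, ?_, by simpa using hk, fun v hv hvS => ?_⟩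
  · rw [Walk.length_reverse, hd, dist_comm]
  · exact (hS v (by simpa using hv) hvS).symm

/-- A walk is at least as long as the increment of a function that grows by at most one
along every edge. -/
theorem SimpleGraph.Walk.sub_le_length {V : Type*} {G : SimpleGraph V} (f : V → ℤ)
    (hf : ∀ u v, G.Adj u v → f v ≤ f u + 1) {x y : V} (p : G.Walk x y) :
    f y - f x ≤ p.length := by
  induction p with
  | nil => simp
  | cons h p ih =>
    have := hf _ _ h
    rw [Walk.length_cons]
    push_cast
    linarith

/-- A height on the corona of a path, which is `1`-Lipschitz and decreases when entering
copy `i`. -/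
def coronaHeight {W : Type*} {r : ℕ} (i : Fin r) : Fin r ⊕ Fin r × W → ℤ
  | Sum.inl k => k
  | Sum.inr (k, _) => if k = i then (k : ℤ) - 1 else k + 1

section CoronaPath

variable {W : Type*} {G : SimpleGraph W} {r : ℕ}

theorem coronaHeight_le (i : Fin r) (u v : Fin r ⊕ Fin r × W)
    (h : (corona (pathGraph r) G).Adj u v) : coronaHeight i v ≤ coronaHeight i u + 1 := by
  rcases u with k | ⟨k, b⟩ <;> rcases v with l | ⟨l, c⟩
  · rw [corona_adj_inl_inl, pathGraph_adj] at h
    simp only [coronaHeight]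
    omega
  · obtain rfl : k = l := by simpa using h
    simp only [coronaHeight]
    split_ifs <;> omega
  · obtain rfl : l = k := by simpa using h
    simp only [coronaHeight]
    split_ifs <;> omega
  · obtain ⟨rfl, -⟩ : k = l ∧ _ := by simpa using h
    simp only [coronaHeight]
    omega

theorem length_inr_inl_ge {i j : Fin r} {b : W}
    (p : (corona (pathGraph r) G).Walk (Sum.inr (i, b)) (Sum.inl j)) :
    (j : ℤ) - i + 1 ≤ p.length := by
  have := p.sub_le_length _ (coronaHeight_le i)
  simp only [coronaHeight, if_true] at this
  linarith

theorem length_inr_inr_ge {i j : Fin r} {b c : W} (hij : i ≠ j)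
    (p : (corona (pathGraph r) G).Walk (Sum.inr (i, b)) (Sum.inr (j, c))) :
    (j : ℤ) - i + 2 ≤ p.length := by
  have := p.sub_le_length _ (coronaHeight_le i)
  simp only [coronaHeight, if_true, if_neg hij.symm] at this
  linarith

/-- The spine of the corona of a path contains a monotone walk between any two of its
vertices. -/
theorem exists_spine_walk (i : Fin r) (d : ℕ) (j : Fin r) (hj : (j : ℕ) = i + d) :
    ∃ p : (corona (pathGraph r) G).Walk (Sum.inl i) (Sum.inl j), p.length = d ∧
      ∀ v ∈ p.support, ∃ k : Fin r, v = Sum.inl k ∧ k ≤ j := by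
  induction d generalizing j with
  | zero =>
    obtain rfl : j = i := Fin.ext (by simpa using hj)
    exact ⟨Walk.nil, rfl, fun v hv => ⟨j, by simpa using hv, le_rfl⟩⟩
  | succ d ih =>
    obtain ⟨p, hp, hS⟩ := ih ⟨i + d, by omega⟩ rfl
    have hadj : (corona (pathGraph r) G).Adj (Sum.inl ⟨i + d, by omega⟩) (Sum.inl j) := by
      rw [corona_adj_inl_inl, pathGraph_adj]
      left
      dsimp only
      omega
    refine ⟨p.concat hadj, by simp [hp], fun v hv => ?_⟩
    rw [Walk.support_concat, List.mem_append] at hv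
    rcases hv with hv | hv
    · obtain ⟨k, rfl, hk⟩ := hS v hv
      refine ⟨k, rfl, ?_⟩
      rw [Fin.le_def] at hk ⊢
      dsimp only at hk
      omega
    · exact ⟨j, by simpa using hv, le_rfl⟩

/-- A walk which is no longer than any other walk with the same ends is a shortest path. -/
theorem SKVisible.of_walk {V : Type*} {G : SimpleGraph V} {S : Set V} {k : ℕ} {x y : V}
    (p : G.Walk x y) (hmin : ∀ q : G.Walk x y, p.length ≤ q.length) (hk : p.length ≤ k)
    (hS : ∀ v ∈ p.support, v ∈ S → v = x ∨ v = y) : SKVisible G S k x y := by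
  have hd : p.length = G.dist x y := by
    obtain ⟨q, hq⟩ := p.reachable.exists_walk_length_eq_dist
    exact le_antisymm (hq ▸ hmin q) (dist_le p)
  exact ⟨p, p.isPath_of_length_eq_dist hd, hd, hk, hS⟩

theorem skVisible_inr_inl {S : Set (Fin r ⊕ Fin r × W)} {i j : Fin r} {b : W} (hij : i ≤ j)
    (hS : ∀ k, Sum.inl k ∈ S → k ≤ j → k = j) :
    SKVisible (corona (pathGraph r) G) S r (Sum.inr (i, b)) (Sum.inl j) := by
  rw [Fin.le_def] at hij
  obtain ⟨p, hp, hps⟩ := exists_spine_walk (G := G) i (j - i) j (by omega)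
  have hadj : (corona (pathGraph r) G).Adj (Sum.inr (i, b)) (Sum.inl i) := by simp
  refine SKVisible.of_walk (Walk.cons hadj p) (fun q => ?_) ?_ fun v hv hvS => ?_
  · have := length_inr_inl_ge q
    rw [Walk.length_cons]
    omega
  · rw [Walk.length_cons]
    omega
  · rw [Walk.support_cons, List.mem_cons] at hv
    refine hv.imp id fun hv => ?_
    obtain ⟨k, rfl, hk⟩ := hps v hv
    rw [hS k hvS hk]

theorem skVisible_inr_inr {S : Set (Fin r ⊕ Fin r × W)} {i j : Fin r} {b c : W} (hij : i < j)
    (hr : (j : ℕ) + 2 ≤ r + i) (hS : ∀ k ≤ j, Sum.inl k ∉ S) :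
    SKVisible (corona (pathGraph r) G) S r (Sum.inr (i, b)) (Sum.inr (j, c)) := by
  have hij' := hij.ne
  rw [Fin.lt_def] at hij
  obtain ⟨p, hp, hps⟩ := exists_spine_walk (G := G) i (j - i) j (by omega)
  have hadj : (corona (pathGraph r) G).Adj (Sum.inr (i, b)) (Sum.inl i) := by simp
  have hadj' : (corona (pathGraph r) G).Adj (Sum.inl j) (Sum.inr (j, c)) := by simp
  refine SKVisible.of_walk (Walk.cons hadj (p.concat hadj')) (fun q => ?_) ?_ fun v hv hvS => ?_
  · have := length_inr_inr_ge hij' q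
    rw [Walk.length_cons, Walk.length_concat]
    omega
  · rw [Walk.length_cons, Walk.length_concat]
    omega
  · rw [Walk.support_cons, List.mem_cons, Walk.support_concat, List.mem_append] at hv
    rcases hv with hv | hv | hv
    · exact Or.inl hv
    · obtain ⟨k, rfl, hk⟩ := hps v hv
      exact absurd hvS (hS k hk)
    · exact Or.inr (by simpa using hv)

end CoronaPath

theorem skVisible_refl {V : Type*} (G : SimpleGraph V) (S : Set V) (k : ℕ) (x : V) :
    SKVisible G S k x x :=
  SKVisible.of_walk Walk.nil (fun _ => Nat.zero_le _) (Nat.zero_le _)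
    fun v hv _ => Or.inl (by simpa using hv)

/-- Two vertices of the same copy of `H` see each other if the root of the copy is free. -/
theorem skVisible_same_copy {α β : Type*} {G : SimpleGraph α} {H : SimpleGraph β}
    {S : Set (α ⊕ α × β)} {k : ℕ} (hk : 2 ≤ k) {a : α} (ha : Sum.inl a ∉ S) (b c : β) :
    SKVisible (corona G H) S k (Sum.inr (a, b)) (Sum.inr (a, c)) := by
  by_cases hbc : b = c
  · subst hbc
    exact skVisible_refl _ _ _ _
  have hne : (Sum.inr (a, b) : α ⊕ α × β) ≠ Sum.inr (a, c) := by simpa using hbc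
  by_cases hadj : H.Adj b c
  · have h : (corona G H).Adj (Sum.inr (a, b)) (Sum.inr (a, c)) := by simpa using hadj
    refine SKVisible.of_walk h.toWalk (fun q => ?_) ?_ fun v hv _ => by simpa using hv
    · have : q.length ≠ 0 := fun h0 => hne (Walk.eq_of_length_eq_zero h0)
      simp only [Adj.toWalk, Walk.length_cons, Walk.length_nil]
      omega
    · simp only [Adj.toWalk, Walk.length_cons, Walk.length_nil]
      omega
  · have h : (corona G H).Adj (Sum.inr (a, b)) (Sum.inl a) := by simp
    have h' : (corona G H).Adj (Sum.inl a) (Sum.inr (a, c)) := by simp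
    refine SKVisible.of_walk (Walk.cons h h'.toWalk) (fun q => ?_) ?_ fun v hv hvS => ?_
    · have h0 : q.length ≠ 0 := fun h0 => hne (Walk.eq_of_length_eq_zero h0)
      have h1 : q.length ≠ 1 := fun h1 => by
        have := Walk.adj_of_length_eq_one h1
        rw [corona_adj_inr_inr] at this
        exact hadj this.2
      simp only [Adj.toWalk, Walk.length_cons, Walk.length_nil]
      omega
    · simpa [Adj.toWalk] using hk
    · have : v = Sum.inr (a, b) ∨ v = Sum.inl a ∨ v = Sum.inr (a, c) := by
        simpa [Adj.toWalk] using hv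
      rcases this with h | rfl | h
      · exact Or.inl h
      · exact absurd hvS ha
      · exact Or.inr h

/-- All copies except the last one, together with the last vertex of the path, form an
`(m + 1)`-distance mutual-visibility set. -/
theorem isKDistMutualVisSet_corona_path {W : Type*} (G : SimpleGraph W) {m : ℕ} (hm : 1 ≤ m)
    {S : Set (Fin (m + 1) ⊕ Fin (m + 1) × W)}
    (hinl : ∀ k, Sum.inl k ∈ S ↔ k = Fin.last m)
    (hinr : ∀ k b, Sum.inr (k, b) ∈ S ↔ k ≠ Fin.last m) :
    IsKDistMutualVisSet (corona (pathGraph (m + 1)) G) (m + 1) S := by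
  have hlt : ∀ k : Fin (m + 1), k ≠ Fin.last m → (k : ℕ) < m := fun k hk =>
    Fin.val_lt_last hk
  have hfree : ∀ j : Fin (m + 1), j ≠ Fin.last m → ∀ k ≤ j, Sum.inl k ∉ S := by
    intro j hj k hk hkS
    rw [hinl] at hkS
    subst hkS
    exact hj (Fin.last_le_iff.mp hk)
  have hlast : ∀ (i : Fin (m + 1)) (b : W),
      SKVisible (corona (pathGraph (m + 1)) G) S (m + 1) (Sum.inr (i, b))
        (Sum.inl (Fin.last m)) := fun i b =>
    skVisible_inr_inl (Fin.le_last i) fun k hk _ => (hinl k).1 hk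
  rintro (i | ⟨i, b⟩) hx (j | ⟨j, c⟩) hy
  · obtain rfl := (hinl i).1 hx
    obtain rfl := (hinl j).1 hy
    exact skVisible_refl _ _ _ _
  · obtain rfl := (hinl i).1 hx
    exact (hlast j c).symm
  · obtain rfl := (hinl j).1 hy
    exact hlast i b
  · have hi := (hinr i b).1 hx
    have hj := (hinr j c).1 hy
    have hi' := hlt i hi
    have hj' := hlt j hj
    rcases lt_trichotomy i j with h | h | h
    · exact skVisible_inr_inr h (by omega) (hfree j hj)
    · subst h
      exact skVisible_same_copy (by omega) (hfree i hi i le_rfl) b c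
    · exact (skVisible_inr_inr h (by omega) (hfree i hi)).symm

theorem card_le_of_isKDistMutualVisSet_corona_path {W : Type*} [Fintype W]
    (G : SimpleGraph W) (hW : 1 ≤ Fintype.card W) {m : ℕ} (hm : 1 ≤ m)
    {S : Finset (Fin (m + 1) ⊕ Fin (m + 1) × W)}
    (hS : IsKDistMutualVisSet (corona (pathGraph (m + 1)) G) (m + 1) (S : Set _)) :
    S.card ≤ m * Fintype.card W + 1 := by
  classical
  by_cases hroot : ∃ i b, Sum.inl i ∈ S ∧ Sum.inr (i, b) ∈ S
  · obtain ⟨i, b, hi, hb⟩ := hroot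
    have hsub : S ⊆ ({i} : Finset _).disjSum (({i} : Finset _) ×ˢ Finset.univ) := by
      intro y hy
      by_contra hne
      obtain ⟨p, -, -, -, hp⟩ := hS (Finset.mem_coe.2 hb) (Finset.mem_coe.2 hy)
      have hmem := corona_root_mem_support p (by rintro c rfl; simp at hne)
      rcases hp _ hmem (Finset.mem_coe.2 hi) with h | rfl
      · simp at h
      · simp at hne
    have := Finset.card_le_card hsub
    rw [Finset.card_disjSum, Finset.card_product, Finset.card_singleton, Finset.card_univ] at this
    nlinarith
  · set A := Finset.univ.filter fun i => Sum.inl i ∈ S with hA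
    set B := Finset.univ.filter fun i => ∃ b, Sum.inr (i, b) ∈ S with hB
    have hsub : S ⊆ A.disjSum (B ×ˢ Finset.univ) := by
      rintro (i | ⟨i, b⟩) hy
      · simpa [hA] using hy
      · simpa [hB] using ⟨b, hy⟩
    have hdisj : Disjoint A B := by
      rw [Finset.disjoint_left]
      intro i hiA hiB
      simp only [hA, hB, Finset.mem_filter, Finset.mem_univ, true_and] at hiA hiB
      obtain ⟨b, hb⟩ := hiB
      exact hroot ⟨i, b, hiA, hb⟩
    have hAB : A.card + B.card ≤ m + 1 := by
      rw [← Finset.card_union_of_disjoint hdisj]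
      simpa using Finset.card_le_univ (A ∪ B)
    have hBm : B.card < m + 1 := by
      have hne : B ≠ Finset.univ := by
        intro h
        have h0 : (0 : Fin (m + 1)) ∈ B := h ▸ Finset.mem_univ _
        have h1 : Fin.last m ∈ B := h ▸ Finset.mem_univ _
        simp only [hB, Finset.mem_filter, Finset.mem_univ, true_and] at h0 h1
        obtain ⟨b, hb⟩ := h0
        obtain ⟨c, hc⟩ := h1
        obtain ⟨p, -, -, hp, -⟩ := hS (Finset.mem_coe.2 hb) (Finset.mem_coe.2 hc)
        have := length_inr_inr_ge
          (by intro h; have := congrArg Fin.val h; simp at this; omega) p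
        simp only [Fin.val_last, Fin.val_zero] at this
        omega
      simpa using (Finset.card_lt_iff_ne_univ B).2 hne
    have := Finset.card_le_card hsub
    rw [Finset.card_disjSum, Finset.card_product, Finset.card_univ] at this
    obtain ⟨t, ht⟩ : ∃ t, m = B.card + t := ⟨m - B.card, by omega⟩
    have hA1 : A.card ≤ t + 1 := by omega
    calc S.card ≤ A.card + B.card * Fintype.card W := this
      _ ≤ (t * Fintype.card W + 1) + B.card * Fintype.card W := by nlinarith
      _ = (B.card + t) * Fintype.card W + 1 := by ring
      _ = m * Fintype.card W + 1 := by rw [← ht]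

/-- For a finite graph `G` on `n ≥ 2` vertices and `r ≥ 3`,
`μ_r(P_r ⊙ G) = (r-1)n + 1`. -/
theorem stmt12 {W : Type*} [Fintype W] (G : SimpleGraph W) (n : ℕ)
    (hn : Fintype.card W = n) (hn2 : 2 ≤ n) (r : ℕ) (hr : 3 ≤ r) :
    kdistMu (corona (SimpleGraph.pathGraph r) G) r = (r - 1) * n + 1 := by
  classical
  obtain ⟨m, rfl⟩ : ∃ m, r = m + 1 := ⟨r - 1, by omega⟩
  subst hn
  refine IsGreatest.csSup_eq ⟨⟨({Fin.last m} : Finset _).disjSum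
    (({Fin.last m} : Finset _)ᶜ ×ˢ Finset.univ), ?_, ?_⟩, ?_⟩
  · exact isKDistMutualVisSet_corona_path G (by omega) (by simp) (by simp)
  · rw [Finset.card_disjSum, Finset.card_product, Finset.card_compl]
    simp [add_comm]
  · rintro _ ⟨S, hS, rfl⟩
    exact card_le_of_isKDistMutualVisSet_corona_path G (by omega) (by omega) hS
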